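/- arXiv:2008.12358 — 2 statements merged into one kernel-verified Lean document; each statement's English description precedes it below -/
import Mathlib

section
/- Let (X,d) be a complete separable metric space and m a nonnegative Borel measure on X, finite on bounded sets, with 0 < m(X) < ∞. Let q ∈ (1,∞), let f ∈ Lip_bs(X), and let c ∈ ℝ be a median of f, i.e. m({f > c}) ≤ m(X)/2 and m({f < c}) ≤ m(X)/2. Then ∫_X lip(f)^q dm ≥ (h(X)/q)^q · ∫_X |f − c|^q dm. -/
open MeasureTheory Filter Topology ENNReal

/-- The slope (pointwise Lipschitz constant) of `f` at `x`, with the convention that it is `0`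
at isolated points. -/
noncomputable def lipSlope {X : Type*} [MetricSpace X] (f : X → ℝ) (x : X) : ℝ :=
  Filter.limsup (fun y => |f y - f x| / dist y x) (𝓝[≠] x)

/-- Lipschitz functions with bounded support. -/
def LipBS {X : Type*} [MetricSpace X] (f : X → ℝ) : Prop :=
  (∃ K : NNReal, LipschitzWith K f) ∧ Bornology.IsBounded (Function.support f)

/-- Functions which are Lipschitz on bounded sets. -/
def LipLoc {X : Type*} [MetricSpace X] (f : X → ℝ) : Prop :=
  ∀ s : Set X, Bornology.IsBounded s → ∃ K : NNReal, LipschitzOnWith K f s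

/-- The perimeter of a Borel set `A`. -/
noncomputable def perimeter {X : Type*} [MetricSpace X] [MeasurableSpace X]
    (m : Measure X) (A : Set X) : ℝ≥0∞ :=
  sInf { p : ℝ≥0∞ | ∃ f : ℕ → X → ℝ, (∀ n, LipLoc (f n)) ∧
    Tendsto (fun n => ∫⁻ x, ENNReal.ofReal |f n x - A.indicator (fun _ => (1:ℝ)) x| ∂m)
      atTop (𝓝 0) ∧
    p = Filter.liminf (fun n => ∫⁻ x, ENNReal.ofReal (lipSlope (f n) x) ∂m) atTop }

/-- The Cheeger constant (finite measure case). -/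
noncomputable def cheegerFin {X : Type*} [MetricSpace X] [MeasurableSpace X]
    (m : Measure X) : ℝ≥0∞ :=
  sInf { h : ℝ≥0∞ | ∃ A : Set X, MeasurableSet A ∧ 0 < m A ∧ m A ≤ m Set.univ / 2 ∧
    h = perimeter m A / m A }

/-- Extended-valued slope. -/
noncomputable def slopeE {X : Type*} [MetricSpace X] (f : X → ℝ) (x : X) : ℝ≥0∞ :=
  Filter.limsup (fun y => ENNReal.ofReal (|f y - f x| / dist y x)) (𝓝[≠] x)

lemma quot_le {X : Type*} [MetricSpace X] {f : X → ℝ} {K : NNReal} (hf : LipschitzWith K f)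
    (x y : X) : |f y - f x| / dist y x ≤ K := by
  have h := hf.dist_le_mul y x
  rw [Real.dist_eq] at h
  exact div_le_of_le_mul₀ dist_nonneg K.2 h

lemma quot_bdd {X : Type*} [MetricSpace X] {f : X → ℝ} {K : NNReal} (hf : LipschitzWith K f)
    (x : X) : IsBoundedUnder (· ≤ ·) (𝓝[≠] x) (fun y => |f y - f x| / dist y x) :=
  isBoundedUnder_of ⟨K, fun y => quot_le hf x y⟩

lemma quot_cobdd {X : Type*} [MetricSpace X] (f : X → ℝ) (x : X) [NeBot (𝓝[≠] x)] :
    IsCoboundedUnder (· ≤ ·) (𝓝[≠] x) (fun y => |f y - f x| / dist y x) :=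
  IsBoundedUnder.isCoboundedUnder_le (isBoundedUnder_of ⟨0, fun y => by positivity⟩)

lemma ofReal_lipSlope {X : Type*} [MetricSpace X] {f : X → ℝ} {K : NNReal}
    (hf : LipschitzWith K f) (x : X) : ENNReal.ofReal (lipSlope f x) = slopeE f x := by
  unfold lipSlope slopeE
  rcases eq_or_neBot (𝓝[≠] x) with h | h
  · rw [h]; simp [Filter.limsup, Filter.limsSup]
  · exact Monotone.map_limsup_of_continuousAt (f := ENNReal.ofReal)
      (fun a b h => ENNReal.ofReal_le_ofReal h) _ ENNReal.continuous_ofReal.continuousAt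
      (quot_bdd hf x) (quot_cobdd f x)

lemma lipSlope_nonneg {X : Type*} [MetricSpace X] {f : X → ℝ} {K : NNReal}
    (hf : LipschitzWith K f) (x : X) : 0 ≤ lipSlope f x := by
  unfold lipSlope
  rcases eq_or_neBot (𝓝[≠] x) with h | h
  · rw [h]; simp [Filter.limsup, Filter.limsSup]
  · exact le_limsup_of_frequently_le (Frequently.of_forall fun y => by positivity) (quot_bdd hf x)

lemma measurable_slopeE {X : Type*} [MetricSpace X] [MeasurableSpace X] [BorelSpace X]
    {f : X → ℝ} (hf : Continuous f) : Measurable (slopeE f) := by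
  classical
  have h1 : slopeE f = fun x => ⨅ n : ℕ, ⨆ y : X,
      (if y ∈ Metric.ball x (1 / ((n : ℝ) + 1)) ∩ {x}ᶜ then
        ENNReal.ofReal (|f y - f x| / dist y x) else 0) := by
    funext x
    unfold slopeE
    rw [(nhdsWithin_hasBasis Metric.nhds_basis_ball_inv_nat_succ {x}ᶜ).limsup_eq_iInf_iSup]
    simp only [iInf_true]
    congr 1; funext n; congr 1; funext y
    split_ifs with h
    · exact iSup_pos h
    · exact iSup_neg h
  rw [h1]
  refine Measurable.iInf fun n => LowerSemicontinuous.measurable ?_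
  refine lowerSemicontinuous_iSup fun y => ?_
  intro x a ha
  dsimp only at ha
  split_ifs at ha with h
  · obtain ⟨hb, hne⟩ := h
    have hne' : x ≠ y := fun e => hne (by simp [e])
    have c1 : ContinuousAt (fun x => ENNReal.ofReal (|f y - f x| / dist y x)) x := by
      refine ENNReal.continuous_ofReal.continuousAt.comp ?_
      refine ContinuousAt.div (by fun_prop) (by fun_prop) ?_
      rw [dist_ne_zero]; exact hne'.symm
    have e1 := c1.eventually (lt_mem_nhds ha)
    have e2 : ∀ᶠ x' in 𝓝 x, x' ≠ y := isOpen_ne.mem_nhds hne'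
    have e3 : ∀ᶠ x' in 𝓝 x, dist y x' < 1 / ((n : ℝ) + 1) := by
      have : ContinuousAt (fun x' => dist y x') x := by fun_prop
      exact this.eventually (gt_mem_nhds hb)
    filter_upwards [e1, e2, e3] with x' h1 h2 h3
    rw [if_pos ⟨h3, fun e => h2 (by simpa using e.symm)⟩]
    exact h1
  · exact absurd ha (by simp)

/-- Test functions. -/
noncomputable def ramp (N t : ℝ) (s : ℝ) : ℝ := min 1 (max 0 (N * (s - t)))

lemma ramp_lip {N : ℝ} (hN : 0 ≤ N) (t a b : ℝ) : |ramp N t a - ramp N t b| ≤ N * |a - b| := by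
  unfold ramp
  calc _ ≤ |max 0 (N * (a - t)) - max 0 (N * (b - t))| := by
        have := abs_min_sub_min_le_max 1 (max 0 (N * (a - t))) 1 (max 0 (N * (b - t)))
        simpa using this
    _ ≤ |N * (a - t) - N * (b - t)| := by
        have := abs_max_sub_max_le_max 0 (N * (a - t)) 0 (N * (b - t))
        simpa using this
    _ = N * |a - b| := by
        rw [← mul_sub, abs_mul, abs_of_nonneg hN]; congr 2; ring

lemma slopeE_ramp_le {X : Type*} [MetricSpace X] {u : X → ℝ} (hu : Continuous u) {N : ℝ}
    (hN : 0 < N) (t : ℝ) (x : X) :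
    slopeE (fun y => ramp N t (u y)) x ≤
      (if t ≤ u x ∧ u x ≤ t + 1 / N then ENNReal.ofReal N * slopeE u x else 0) := by
  have key : (∀ᶠ y in 𝓝 x, ramp N t (u y) = ramp N t (u x)) →
      slopeE (fun y => ramp N t (u y)) x ≤ 0 := by
    intro h
    unfold slopeE
    refine limsup_le_of_le (h := ?_)
    filter_upwards [h.filter_mono nhdsWithin_le_nhds] with y hy
    simp [hy]
  split_ifs with h
  · unfold slopeE
    rw [← ENNReal.limsup_const_mul_of_ne_top ENNReal.ofReal_ne_top]
    refine limsup_le_limsup (Eventually.of_forall fun y => ?_)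
    dsimp only
    rw [← ENNReal.ofReal_mul hN.le, ← mul_div_assoc]
    exact ENNReal.ofReal_le_ofReal
      (div_le_div_of_nonneg_right (ramp_lip hN.le t _ _) dist_nonneg)
  · apply key
    by_cases h1 : t ≤ u x
    · have h2 : t + 1 / N < u x := by
        by_contra h3; exact h ⟨h1, not_lt.1 h3⟩
      have : ∀ s, t + 1 / N < s → ramp N t s = 1 := by
        intro s hs
        have : 1 ≤ N * (s - t) := by
          have : 1 / N ≤ s - t := by linarith
          rw [div_le_iff₀ hN] at this; linarith
        exact min_eq_left (le_max_of_le_right this)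
      filter_upwards [hu.continuousAt.eventually (lt_mem_nhds h2)] with y hy
      rw [this _ hy, this _ h2]
    · have h2 : u x < t := not_le.1 h1
      have : ∀ s, s < t → ramp N t s = 0 := by
        intro s hs
        have : N * (s - t) ≤ 0 := by nlinarith
        unfold ramp; rw [max_eq_left this]; simp
      filter_upwards [hu.continuousAt.eventually (gt_mem_nhds h2)] with y hy
      rw [this _ hy, this _ h2]

lemma ramp_tendsto (t s : ℝ) : Tendsto (fun n : ℕ => |ramp ((n : ℝ) + 1) t s -
    (if t < s then 1 else 0)|) atTop (𝓝 0) := by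
  split_ifs with h
  · refine tendsto_const_nhds.congr' ?_
    obtain ⟨n0, hn0⟩ := exists_nat_gt (1 / (s - t))
    filter_upwards [eventually_ge_atTop n0] with n hn
    have h0 : 0 < s - t := by linarith
    have : 1 ≤ ((n : ℝ) + 1) * (s - t) := by
      rw [div_lt_iff₀ h0] at hn0
      have : (n0 : ℝ) ≤ n := by exact_mod_cast hn
      nlinarith
    unfold ramp
    rw [min_eq_left (le_max_of_le_right this)]; simp
  · refine tendsto_const_nhds.congr fun n => ?_
    have : ((n : ℝ) + 1) * (s - t) ≤ 0 :=
      mul_nonpos_of_nonneg_of_nonpos (by positivity) (by linarith)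
    unfold ramp; rw [max_eq_left this]; simp

lemma perimeter_superlevel_le {X : Type*} [MetricSpace X] [MeasurableSpace X] [BorelSpace X]
    (m : Measure X) (hfin : m Set.univ < ⊤) {u : X → ℝ} {K : NNReal} (hu : LipschitzWith K u)
    (t : ℝ) :
    perimeter m {x | t < u x} ≤ liminf (fun n : ℕ => ∫⁻ x,
      (if t ≤ u x ∧ u x ≤ t + 1 / ((n : ℝ) + 1) then
        ENNReal.ofReal ((n : ℝ) + 1) * slopeE u x else 0) ∂m) atTop := by
  have hL : ∀ n : ℕ, LipschitzWith (((n : NNReal) + 1) * K)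
      (fun y => ramp ((n : ℝ) + 1) t (u y)) := by
    intro n
    refine LipschitzWith.of_dist_le_mul fun a b => ?_
    rw [Real.dist_eq]
    refine (ramp_lip (by positivity) t _ _).trans ?_
    have := hu.dist_le_mul a b
    rw [Real.dist_eq] at this
    push_cast
    rw [mul_assoc]
    gcongr
  refine le_trans (sInf_le ⟨fun n y => ramp ((n : ℝ) + 1) t (u y), fun n s _ =>
    ⟨_, (hL n).lipschitzOnWith⟩, ?_, rfl⟩) ?_
  · have hm : MeasurableSet {x | t < u x} := measurableSet_lt measurable_const
      hu.continuous.measurable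
    have := tendsto_lintegral_of_dominated_convergence (μ := m)
      (F := fun n x => ENNReal.ofReal |ramp ((n : ℝ) + 1) t (u x) -
        ({x | t < u x} : Set X).indicator (fun _ => (1:ℝ)) x|) (f := fun _ => 0)
      (bound := fun _ => 1) ?_ ?_ ?_ ?_
    · simpa using this
    · intro n
      refine ENNReal.measurable_ofReal.comp ?_
      refine measurable_norm.comp (((hL n).continuous.measurable).sub
        (measurable_const.indicator hm))
    · intro n
      refine Eventually.of_forall fun x => ?_
      dsimp only
      rw [← ENNReal.ofReal_one]
      refine ENNReal.ofReal_le_ofReal ?_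
      have h1 : 0 ≤ ramp ((n : ℝ) + 1) t (u x) := le_min zero_le_one (le_max_left _ _)
      have h2 : ramp ((n : ℝ) + 1) t (u x) ≤ 1 := min_le_left _ _
      by_cases h : t < u x
      · simp only [Set.indicator, Set.mem_ofPred_eq, h, if_true]
        rw [abs_le]; constructor <;> linarith
      · simp only [Set.indicator, Set.mem_ofPred_eq, h, if_false]
        rw [abs_le]; constructor <;> linarith
    · simpa using hfin.ne
    · refine Eventually.of_forall fun x => ?_
      rw [← ENNReal.ofReal_zero]
      refine ENNReal.tendsto_ofReal ?_
      simpa [Set.indicator] using ramp_tendsto t (u x)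
  · refine liminf_le_liminf (Eventually.of_forall fun n => ?_)
    refine lintegral_mono fun x => ?_
    dsimp only
    rw [ofReal_lipSlope (hL n)]
    exact slopeE_ramp_le hu.continuous (by positivity) t x

lemma cheeger_mul_le {X : Type*} [MetricSpace X] [MeasurableSpace X]
    (m : Measure X) (hfin : m Set.univ < ⊤) {A : Set X} (hA : MeasurableSet A)
    (h2 : m A ≤ m Set.univ / 2) : cheegerFin m * m A ≤ perimeter m A := by
  by_cases h0 : m A = 0
  · simp [h0]
  · have : m A ≠ ⊤ := ((measure_mono (Set.subset_univ A)).trans_lt hfin).ne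
    rw [← ENNReal.le_div_iff_mul_le (Or.inl h0) (Or.inl this)]
    exact sInf_le ⟨A, hA, pos_iff_ne_zero.2 h0, h2, rfl⟩

lemma coarea_pow {X : Type*} [MetricSpace X] [MeasurableSpace X] [BorelSpace X]
    (m : Measure X) (hfin : m Set.univ < ⊤) {u : X → ℝ} {K : NNReal} (hu : LipschitzWith K u)
    (hmed : m {x | 0 < u x} ≤ m Set.univ / 2) {q : ℝ} (hq : 1 < q) :
    cheegerFin m * ∫⁻ x, ENNReal.ofReal (max (u x) 0 ^ q) ∂m ≤
      ENNReal.ofReal q * ∫⁻ x, slopeE u x * ENNReal.ofReal (max (u x) 0 ^ (q - 1)) ∂m := by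
  have : IsFiniteMeasure m := ⟨hfin⟩
  have hum : Measurable u := hu.continuous.measurable
  have hsm : Measurable (slopeE u) := measurable_slopeE hu.continuous
  set W : ℕ → ℝ → X → ℝ≥0∞ := fun n t x =>
      (if t ≤ u x ∧ u x ≤ t + 1 / ((n : ℝ) + 1) then
        ENNReal.ofReal ((n : ℝ) + 1) * slopeE u x else 0) with hW
  have hWm : ∀ n, Measurable (fun p : ℝ × X => W n p.1 p.2) := by
    intro n
    refine Measurable.ite ?_ (measurable_const.mul (hsm.comp measurable_snd)) measurable_const
    exact (measurableSet_le measurable_fst (hum.comp measurable_snd)).inter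
      (measurableSet_le (hum.comp measurable_snd) (measurable_fst.add_const _))
  set w : ℝ → ℝ≥0∞ := fun t => ENNReal.ofReal (t ^ (q - 1)) with hw
  have hwm : Measurable w := by
    refine ENNReal.measurable_ofReal.comp ?_
    exact measurable_id.pow_const _
  rw [lintegral_rpow_eq_lintegral_meas_lt_mul m (f := fun x => max (u x) 0) (Eventually.of_forall fun x => le_max_right _ _)
    (hum.max measurable_const).aemeasurable (by linarith), mul_left_comm]
  refine mul_le_mul_right ?_ _
  have hanti : Measurable (fun t : ℝ => m {a | t < max (u a) 0}) := by
    refine Antitone.measurable fun a b hab => measure_mono fun x hx => ?_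
    exact lt_of_le_of_lt hab hx
  have hprod : Measurable (fun t : ℝ => m {a | t < max (u a) 0} * w t) := hanti.mul hwm
  change cheegerFin m * ∫⁻ t in Set.Ioi (0:ℝ), m {a | t < max (u a) 0} * w t ≤ _
  rw [← lintegral_const_mul _ hprod]
  calc ∫⁻ t in Set.Ioi (0:ℝ), cheegerFin m * (m {a | t < max (u a) 0} * w t)
      ≤ ∫⁻ t in Set.Ioi (0:ℝ), liminf (fun n => (∫⁻ x, W n t x ∂m) * w t) atTop := by
        refine setLIntegral_mono' measurableSet_Ioi fun t ht => ?_
        have ht : 0 < t := ht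
        have hset : {a | t < max (u a) 0} = {a | t < u a} := by
          ext a; simp [ht.le]
        rw [hset, ENNReal.liminf_mul_const_of_ne_top ENNReal.ofReal_ne_top, ← mul_assoc, mul_comm (w t)]
        refine mul_le_mul' ?_ le_rfl
        refine (cheeger_mul_le m hfin (measurableSet_lt measurable_const hum) ?_).trans
          (perimeter_superlevel_le m hfin hu t)
        exact (measure_mono fun x (hx : t < u x) => ht.trans hx).trans hmed
    _ ≤ liminf (fun n => ∫⁻ t in Set.Ioi (0:ℝ), (∫⁻ x, W n t x ∂m) * w t) atTop :=
        lintegral_liminf_le fun n => (hWm n).lintegral_prod_right'.mul hwm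
    _ ≤ liminf (fun _ : ℕ => ∫⁻ x, slopeE u x * ENNReal.ofReal (max (u x) 0 ^ (q - 1)) ∂m)
          atTop := by
        refine liminf_le_liminf (Eventually.of_forall fun n => ?_)
        have e1 : ∀ t, (∫⁻ x, W n t x ∂m) * w t = ∫⁻ x, W n t x * w t ∂m := fun t =>
          (lintegral_mul_const _ ((hWm n).comp measurable_prodMk_left)).symm
        simp_rw [e1]
        rw [lintegral_lintegral_swap
          (((hWm n).mul (hwm.comp measurable_fst)).aemeasurable)]
        refine lintegral_mono fun x => ?_
        have hpos : (0:ℝ) < (n : ℝ) + 1 := by positivity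
        calc ∫⁻ t in Set.Ioi (0:ℝ), W n t x * w t
            ≤ ∫⁻ t in Set.Ioi (0:ℝ), (Set.Icc (u x - 1 / ((n : ℝ) + 1)) (u x)).indicator
                (fun _ => ENNReal.ofReal ((n : ℝ) + 1) * slopeE u x *
                  ENNReal.ofReal (max (u x) 0 ^ (q - 1))) t := by
              refine setLIntegral_mono' measurableSet_Ioi fun t ht => ?_
              have ht : 0 < t := ht
              by_cases h : t ≤ u x ∧ u x ≤ t + 1 / ((n : ℝ) + 1)
              · have hmem : t ∈ Set.Icc (u x - 1 / ((n : ℝ) + 1)) (u x) :=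
                  ⟨by linarith [h.2], h.1⟩
                rw [Set.indicator_of_mem hmem]
                simp only [hW, hw, if_pos h]
                gcongr
                · exact h.1.trans (le_max_left _ _)
              · simp only [hW, if_neg h, zero_mul]
                exact zero_le
          _ ≤ ∫⁻ t, (Set.Icc (u x - 1 / ((n : ℝ) + 1)) (u x)).indicator
                (fun _ => ENNReal.ofReal ((n : ℝ) + 1) * slopeE u x *
                  ENNReal.ofReal (max (u x) 0 ^ (q - 1))) t := setLIntegral_le_lintegral _ _
          _ = slopeE u x * ENNReal.ofReal (max (u x) 0 ^ (q - 1)) := by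
              rw [lintegral_indicator_const measurableSet_Icc, Real.volume_Icc]
              have : ENNReal.ofReal ((n : ℝ) + 1) *
                  ENNReal.ofReal (u x - (u x - 1 / ((n : ℝ) + 1))) = 1 := by
                rw [← ENNReal.ofReal_mul hpos.le]
                rw [← ENNReal.ofReal_one]; congr 1; field_simp; ring
              calc _ = (ENNReal.ofReal ((n : ℝ) + 1) *
                  ENNReal.ofReal (u x - (u x - 1 / ((n : ℝ) + 1)))) *
                  (slopeE u x * ENNReal.ofReal (max (u x) 0 ^ (q - 1))) := by ring
                _ = _ := by rw [this, one_mul]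
    _ = _ := liminf_const _

/-- For a complete separable metric measure space with `0 < m(X) < ∞` and `m` finite on
bounded sets, for every `q ∈ (1,∞)`, every `f ∈ Lip_bs(X)` and every median `c` of `f`
(i.e. `m({f > c}) ≤ m(X)/2` and `m({f < c}) ≤ m(X)/2`), one has
`∫ lip(f)^q dm ≥ (h(X)/q)^q · ∫ |f - c|^q dm`. -/
theorem lip_q_ge_cheeger_median {X : Type*} [MetricSpace X] [CompleteSpace X]
    [TopologicalSpace.SeparableSpace X] [MeasurableSpace X] [BorelSpace X]
    (m : Measure X)
    (hbdd : ∀ s : Set X, Bornology.IsBounded s → m s < ⊤)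
    (hpos : 0 < m Set.univ) (hfin : m Set.univ < ⊤)
    (q : ℝ) (hq : 1 < q)
    (f : X → ℝ) (hf : LipBS f) (c : ℝ)
    (hmed₁ : m {x | c < f x} ≤ m Set.univ / 2)
    (hmed₂ : m {x | f x < c} ≤ m Set.univ / 2) :
    (cheegerFin m / ENNReal.ofReal q) ^ q * (∫⁻ x, ENNReal.ofReal (|f x - c| ^ q) ∂m) ≤
      ∫⁻ x, ENNReal.ofReal ((lipSlope f x) ^ q) ∂m := by

  obtain ⟨⟨K, hK⟩, hsupp⟩ := hf
  have : IsFiniteMeasure m := ⟨hfin⟩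
  have hfm : Measurable f := hK.continuous.measurable
  have hq0 : 0 < q := by linarith
  set h := cheegerFin m
  -- boundedness
  obtain ⟨C, hC⟩ : ∃ C : ℝ, ∀ x, |f x| ≤ C := by
    have hb : Bornology.IsBounded (f '' Function.support f) := hK.isBounded_image hsupp
    obtain ⟨C, hC⟩ := hb.exists_norm_le
    refine ⟨max C 0, fun x => ?_⟩
    by_cases hx : f x = 0
    · simp [hx]
    · exact (hC _ ⟨x, hx, rfl⟩).trans (le_max_left _ _)
  have hsub : ∀ x, |f x - c| ≤ C + |c| := fun x =>
    (abs_sub _ _).trans (by linarith [hC x])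
  have hslope2 : slopeE (fun x => c - f x) = slopeE f := by
    funext x
    unfold slopeE
    congr 1; funext y
    rw [← abs_neg]; congr 3; ring
  have hslope1 : slopeE (fun x => f x - c) = slopeE f := by
    funext x
    unfold slopeE
    congr 1; funext y
    congr 3; ring
  have hL1 : LipschitzWith K (fun x => f x - c) :=
    LipschitzWith.of_dist_le_mul fun a b => by
      simpa [Real.dist_eq] using hK.dist_le_mul a b
  have hL2 : LipschitzWith K (fun x => c - f x) :=
    LipschitzWith.of_dist_le_mul fun a b => by
      have := hK.dist_le_mul a b
      rw [Real.dist_eq] at this ⊢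
      rw [← abs_neg]; convert this using 2; ring
  have k1 := coarea_pow m hfin hL1 (by simpa using hmed₁) hq
  have k2 := coarea_pow m hfin hL2 (by simpa using hmed₂) hq
  rw [hslope1] at k1
  rw [hslope2] at k2
  have split : ∀ p : ℝ, 0 < p → ∀ x, ENNReal.ofReal (|f x - c| ^ p) =
      ENNReal.ofReal (max (f x - c) 0 ^ p) + ENNReal.ofReal (max (c - f x) 0 ^ p) := by
    intro p hp x
    rcases le_total 0 (f x - c) with h0 | h0
    · rw [abs_of_nonneg h0, max_eq_left h0, max_eq_right (by linarith), Real.zero_rpow hp.ne']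
      simp
    · rw [abs_of_nonpos h0, max_eq_right h0, max_eq_left (by linarith), Real.zero_rpow hp.ne']
      simp
  have hsm : Measurable (slopeE f) := measurable_slopeE hK.continuous
  have m1 : ∀ p : ℝ, Measurable fun x => ENNReal.ofReal (max (f x - c) 0 ^ p) := fun p =>
    ENNReal.measurable_ofReal.comp (((hfm.sub_const c).max measurable_const).pow_const p)
  have m3 : Measurable fun x => ENNReal.ofReal (|f x - c| ^ (q - 1)) :=
    ENNReal.measurable_ofReal.comp
      ((measurable_norm.comp (hfm.sub_const c)).pow_const (q - 1))
  set I := ∫⁻ x, ENNReal.ofReal (|f x - c| ^ q) ∂m with hI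
  set L := ∫⁻ x, ENNReal.ofReal (lipSlope f x ^ q) ∂m with hLdef
  have hLe : L = ∫⁻ x, slopeE f x ^ q ∂m := by
    refine lintegral_congr fun x => ?_
    rw [← ENNReal.ofReal_rpow_of_nonneg (lipSlope_nonneg hK x) hq0.le, ofReal_lipSlope hK]
  have main : h * I ≤ ENNReal.ofReal q *
      ∫⁻ x, slopeE f x * ENNReal.ofReal (|f x - c| ^ (q - 1)) ∂m := by
    have a1 : I = ∫⁻ x, ENNReal.ofReal (max (f x - c) 0 ^ q) ∂m +
        ∫⁻ x, ENNReal.ofReal (max (c - f x) 0 ^ q) ∂m := by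
      rw [← lintegral_add_left (m1 q)]
      exact lintegral_congr (split q hq0)
    have a2 : ∫⁻ x, slopeE f x * ENNReal.ofReal (|f x - c| ^ (q - 1)) ∂m =
        ∫⁻ x, slopeE f x * ENNReal.ofReal (max (f x - c) 0 ^ (q - 1)) ∂m +
        ∫⁻ x, slopeE f x * ENNReal.ofReal (max (c - f x) 0 ^ (q - 1)) ∂m := by
      have m4 : Measurable fun x => slopeE f x * ENNReal.ofReal (max (f x - c) 0 ^ (q - 1)) :=
        hsm.mul (m1 (q - 1))
      rw [← lintegral_add_left m4]
      refine lintegral_congr fun x => ?_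
      rw [split (q - 1) (by linarith) x, mul_add]
    rw [a1, a2, mul_add, mul_add]
    exact add_le_add k1 k2
  have hconj : q.HolderConjugate (q / (q - 1)) := Real.HolderConjugate.conjExponent hq
  have hold := ENNReal.lintegral_mul_le_Lp_mul_Lq m hconj hsm.aemeasurable m3.aemeasurable
  have hpow : ∀ x, ENNReal.ofReal (|f x - c| ^ (q - 1)) ^ (q / (q - 1)) =
      ENNReal.ofReal (|f x - c| ^ q) := by
    intro x
    have : 0 < q - 1 := by linarith
    rw [ENNReal.ofReal_rpow_of_nonneg (by positivity) (by positivity),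
      ← Real.rpow_mul (abs_nonneg _)]
    congr 2; field_simp
  simp_rw [hpow, ← hI, ← hLe] at hold
  have hItop : I ≠ ⊤ := by
    have : I ≤ ∫⁻ x, ENNReal.ofReal ((C + |c|) ^ q) ∂m := by
      refine lintegral_mono fun x => ENNReal.ofReal_le_ofReal ?_
      exact Real.rpow_le_rpow (abs_nonneg _) (hsub x) hq0.le
    refine ne_top_of_le_ne_top ?_ this
    rw [lintegral_const]
    exact ENNReal.mul_ne_top ENNReal.ofReal_ne_top hfin.ne
  by_cases hI0 : I = 0
  · simp [hI0]
  have hmain2 : h * I ≤ ENNReal.ofReal q * (L ^ (1 / q) * I ^ (1 / (q / (q - 1)))) :=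
    main.trans (mul_le_mul_right hold _)
  have hexp : 1 / (q / (q - 1)) = 1 - 1 / q := by field_simp
  have hIs : I = I ^ (1 / q) * I ^ (1 - 1 / q) := by
    rw [← ENNReal.rpow_add _ _ hI0 hItop]; simp
  have hJ0 : I ^ (1 - 1 / q) ≠ 0 := by
    simp [ENNReal.rpow_eq_zero_iff, hI0, hItop]
  have hJt : I ^ (1 - 1 / q) ≠ ⊤ := by
    simp [ENNReal.rpow_eq_top_iff, hI0, hItop]
  have hfinal : h * I ^ (1 / q) ≤ ENNReal.ofReal q * L ^ (1 / q) := by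
    rw [hexp] at hmain2
    nth_rewrite 1 [hIs] at hmain2
    rw [← mul_assoc, ← mul_assoc] at hmain2
    exact (ENNReal.mul_le_mul_iff_left hJ0 hJt).1 hmain2
  have hqe0 : ENNReal.ofReal q ≠ 0 := by simpa using hq0
  have hdiv : h / ENNReal.ofReal q * I ^ (1 / q) ≤ L ^ (1 / q) := by
    rw [mul_comm, ← mul_div_assoc, mul_comm]
    exact ENNReal.div_le_of_le_mul' hfinal
  have := ENNReal.rpow_le_rpow hdiv hq0.le
  rwa [ENNReal.mul_rpow_of_nonneg _ _ hq0.le, ← ENNReal.rpow_mul, ← ENNReal.rpow_mul,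
    one_div_mul_cancel hq0.ne', ENNReal.rpow_one, ENNReal.rpow_one] at this
end

section
/- Let (X,d) be a complete metric space and m a nonnegative Borel measure on X, finite on bounded sets, with supp(m) = X, m(X) ∈ (0,∞], and diam(X) > 0. Then the Cheeger constant is finite: h(X) ∈ [0,∞). -/
open MeasureTheory Filter Topology ENNReal

/-- The Cheeger constant: if `m(X) < ∞` the infimum of `Per(A)/m(A)` over Borel sets with
`0 < m(A) ≤ m(X)/2`; if `m(X) = ∞` the infimum over Borel sets with `0 < m(A) < ∞`. -/
noncomputable def cheegerConst {X : Type*} [MetricSpace X] [MeasurableSpace X]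
    (m : Measure X) : ℝ≥0∞ :=
  if m Set.univ < ⊤ then
    sInf { h : ℝ≥0∞ | ∃ A : Set X, MeasurableSet A ∧ 0 < m A ∧ m A ≤ m Set.univ / 2 ∧
      h = perimeter m A / m A }
  else
    sInf { h : ℝ≥0∞ | ∃ A : Set X, MeasurableSet A ∧ 0 < m A ∧ m A < ⊤ ∧
      h = perimeter m A / m A }

open Metric in
theorem exists_radius {X : Type*} [MetricSpace X] [MeasurableSpace X] [BorelSpace X]
    (m : Measure X) (hbdd : ∀ s : Set X, Bornology.IsBounded s → m s < ⊤) (x : X)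
    (r : ℝ) (hr : 0 < r) :
    ∃ s, 0 < s ∧ s < r ∧ ∃ C : ℝ, ∀ᶠ t in 𝓝 s, s ≤ t →
      m (closedBall x t \ closedBall x s) ≤ ENNReal.ofReal (C * (t - s)) := by
  have hfin : ∀ t, m (closedBall x t) ≠ ⊤ := fun t => (hbdd _ isBounded_closedBall).ne
  have hmono : Monotone (fun t : ℝ => (m (closedBall x t)).toReal) := fun a b hab =>
    ENNReal.toReal_mono (hfin b) (measure_mono (closedBall_subset_closedBall hab))
  have hae := hmono.ae_differentiableAt
  have : ∃ s ∈ Set.Ioo 0 r, DifferentiableAt ℝ (fun t : ℝ => (m (closedBall x t)).toReal) s := by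
    by_contra! hcon
    have h0 : volume (Set.Ioo (0:ℝ) r) = 0 := measure_mono_null (fun s hs => hcon s hs) hae
    rw [Real.volume_Ioo] at h0
    simp at h0
    linarith
  obtain ⟨s, hs, hd⟩ := this
  refine ⟨s, hs.1, hs.2, ?_⟩
  obtain ⟨C, hC⟩ := hd.isBigO_sub.bound
  refine ⟨C, ?_⟩
  filter_upwards [hC] with t ht hst
  rw [measure_diff (closedBall_subset_closedBall hst) measurableSet_closedBall.nullMeasurableSet
    (hfin s), ← ENNReal.ofReal_toReal (hfin t), ← ENNReal.ofReal_toReal (hfin s),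
    ← ENNReal.ofReal_sub _ ENNReal.toReal_nonneg]
  apply ENNReal.ofReal_le_ofReal
  rw [Real.norm_eq_abs, Real.norm_eq_abs, abs_of_nonneg (sub_nonneg.2 hst)] at ht
  exact (le_abs_self _).trans ht

theorem lipSlope_le {X : Type*} [MetricSpace X] (f : X → ℝ) (K : NNReal) (hf : LipschitzWith K f)
    (x : X) : lipSlope f x ≤ K := by
  unfold lipSlope
  rcases (𝓝[≠] x).eq_or_neBot with h | h
  · rw [h]; simp [Filter.limsup_eq]
  · refine Filter.limsup_le_of_le ?_ ?_
    · exact Filter.IsCoboundedUnder.of_frequently_ge (a := 0)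
        (Filter.Eventually.frequently (Filter.Eventually.of_forall fun y => by positivity))
    · refine Filter.Eventually.of_forall fun y => ?_
      apply div_le_of_le_mul₀ dist_nonneg K.2
      have := hf.dist_le_mul y x
      rwa [Real.dist_eq] at this

theorem lipSlope_eq_zero {X : Type*} [MetricSpace X] (f : X → ℝ) (x : X)
    (hf : ∀ᶠ y in 𝓝 x, f y = f x) : lipSlope f x = 0 := by
  unfold lipSlope
  rcases (𝓝[≠] x).eq_or_neBot with h | h
  · rw [h]; simp [Filter.limsup_eq]
  · rw [Filter.limsup_congr (v := fun _ => (0:ℝ))]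
    · simp
    · filter_upwards [hf.filter_mono nhdsWithin_le_nhds] with y hy
      simp [hy]

/-- Cutoff function. -/
noncomputable def cutoff {X : Type*} [MetricSpace X] (x : X) (s : ℝ) (k : NNReal) (y : X) : ℝ :=
  max 0 (min 1 (2 + k * (s - dist y x)))

theorem cutoff_lip {X : Type*} [MetricSpace X] (x : X) (s : ℝ) (k : NNReal) :
    LipschitzWith k (cutoff x s k) := by
  have h : LipschitzWith k (fun y : X => 2 + (k:ℝ) * (s - dist y x)) := by
    refine LipschitzWith.of_dist_le_mul fun y z => ?_
    rw [Real.dist_eq]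
    have : 2 + (k:ℝ) * (s - dist y x) - (2 + k * (s - dist z x)) = k * (dist z x - dist y x) := by
      ring
    rw [this, abs_mul, abs_of_nonneg k.coe_nonneg]
    apply mul_le_mul_of_nonneg_left _ k.coe_nonneg
    rw [dist_comm y z]
    exact abs_dist_sub_le z y x
  exact (h.const_min 1).const_max 0

open Metric in
theorem perimeter_lt_top {X : Type*} [MetricSpace X] [MeasurableSpace X] [BorelSpace X]
    (m : Measure X) (x : X) (s C : ℝ)
    (h : ∀ᶠ t in 𝓝 s, s ≤ t →
      m (closedBall x t \ closedBall x s) ≤ ENNReal.ofReal (C * (t - s))) :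
    perimeter m (closedBall x s) < ⊤ := by
  set k : ℕ → NNReal := fun n => n + 1 with hk
  have hkpos : ∀ n, (0:ℝ) < k n := fun n => by simp only [hk]; positivity
  have hlim0 : Tendsto (fun n : ℕ => 2 / (k n : ℝ)) atTop (𝓝 0) := by
    have := (tendsto_one_div_add_atTop_nhds_zero_nat (𝕜 := ℝ)).const_mul 2
    simpa [hk, div_eq_mul_inv] using this
  have hlim : Tendsto (fun n : ℕ => s + 2 / (k n : ℝ)) atTop (𝓝 s) := by
    simpa using hlim0.const_add s
  have hev : ∀ᶠ n in atTop, m (closedBall x (s + 2 / (k n : ℝ)) \ closedBall x s)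
      ≤ ENNReal.ofReal (C * (2 / (k n : ℝ))) := by
    filter_upwards [hlim.eventually h] with n hn
    have := hn (by have := hkpos n; have : 0 < 2 / (k n : ℝ) := by positivity
                   linarith)
    simpa using this
  have hmeas : ∀ n, MeasurableSet (closedBall x (s + 2 / (k n : ℝ)) \ closedBall x s) :=
    fun n => measurableSet_closedBall.diff measurableSet_closedBall
  -- values of the cutoff
  have hone : ∀ n (y : X), dist y x ≤ s + 1 / (k n : ℝ) → cutoff x s (k n) y = 1 := by
    intro n y hy
    have h1 : (k n : ℝ) * (dist y x - s) ≤ 1 := by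
      have := mul_le_mul_of_nonneg_left (sub_le_iff_le_add'.2 hy) (hkpos n).le
      rwa [mul_one_div_cancel (hkpos n).ne'] at this
    unfold cutoff
    rw [min_eq_left (by nlinarith)]
    simp
  have hzero : ∀ n (y : X), s + 2 / (k n : ℝ) ≤ dist y x → cutoff x s (k n) y = 0 := by
    intro n y hy
    have h1 : 2 ≤ (k n : ℝ) * (dist y x - s) := by
      have := mul_le_mul_of_nonneg_left (le_sub_iff_add_le'.2 hy) (hkpos n).le
      rwa [mul_div_cancel₀ _ (hkpos n).ne'] at this
    unfold cutoff
    exact max_eq_left ((min_le_right _ _).trans (by nlinarith))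
  have hle1 : ∀ n (y : X), cutoff x s (k n) y ≤ 1 := fun n y =>
    max_le zero_le_one (min_le_left _ _)
  have hge0 : ∀ n (y : X), 0 ≤ cutoff x s (k n) y := fun n y => le_max_left _ _
  have hinv : ∀ n, 0 < 1 / (k n : ℝ) := fun n => one_div_pos.2 (hkpos n)
  have hslope : ∀ n, ∫⁻ y, ENNReal.ofReal (lipSlope (cutoff x s (k n)) y) ∂m
      ≤ k n * m (closedBall x (s + 2 / (k n : ℝ)) \ closedBall x s) := by
    intro n
    rw [← lintegral_indicator_const (hmeas n)]
    apply lintegral_mono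
    intro y
    by_cases hy : y ∈ closedBall x (s + 2 / (k n : ℝ)) \ closedBall x s
    · simp only [Set.indicator_of_mem hy]
      refine (ENNReal.ofReal_le_ofReal (lipSlope_le _ _ (cutoff_lip x s (k n)) y)).trans ?_
      simp
    · simp only [Set.indicator_of_notMem hy]
      rw [lipSlope_eq_zero, ENNReal.ofReal_zero]
      by_cases hys : dist y x ≤ s
      · have hc : ∀ᶠ z in 𝓝 y, dist z x < s + 1 / (k n : ℝ) :=
          (continuous_id.dist continuous_const).continuousAt.eventually_lt
            continuousAt_const (lt_of_le_of_lt hys (by linarith [hinv n]))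
        filter_upwards [hc] with z hz
        rw [hone n z hz.le, hone n y (hys.trans (by linarith [hinv n]))]
      · have hys' : s + 2 / (k n : ℝ) < dist y x := by
          by_contra hcon
          exact hy ⟨mem_closedBall.2 (not_lt.1 hcon), fun h => hys (mem_closedBall.1 h)⟩
        have hc : ∀ᶠ z in 𝓝 y, s + 2 / (k n : ℝ) < dist z x :=
          continuousAt_const.eventually_lt
            (continuous_id.dist continuous_const).continuousAt hys'
        filter_upwards [hc] with z hz
        rw [hzero n z hz.le, hzero n y hys'.le]
  have hdiff : ∀ n, ∫⁻ y, ENNReal.ofReal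
      |cutoff x s (k n) y - (closedBall x s).indicator (fun _ => (1:ℝ)) y| ∂m
      ≤ m (closedBall x (s + 2 / (k n : ℝ)) \ closedBall x s) := by
    intro n
    rw [← one_mul (m _), ← lintegral_indicator_const (hmeas n)]
    apply lintegral_mono
    intro y
    by_cases hys : y ∈ closedBall x s
    · simp only [Set.indicator_of_mem hys]
      rw [hone n y ((mem_closedBall.1 hys).trans (by linarith [hinv n]))]
      simp
    · simp only [Set.indicator_of_notMem hys]
      by_cases hy : y ∈ closedBall x (s + 2 / (k n : ℝ))
      · rw [Set.indicator_of_mem (Set.mem_diff_of_mem hy hys), sub_zero, abs_of_nonneg (hge0 n y)]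
        simpa using ENNReal.ofReal_le_ofReal (hle1 n y)
      · rw [hzero n y (not_le.1 (fun h => hy (mem_closedBall.2 h))).le]
        simp
  have hmem : perimeter m (closedBall x s) ≤ liminf
      (fun n => ∫⁻ y, ENNReal.ofReal (lipSlope (cutoff x s (k n)) y) ∂m) atTop := by
    refine sInf_le ⟨fun n => cutoff x s (k n), fun n t _ => ⟨k n, (cutoff_lip x s _).lipschitzOnWith⟩,
      ?_, rfl⟩
    have h0 : Tendsto (fun n => ENNReal.ofReal (C * (2 / (k n : ℝ)))) atTop (𝓝 0) := by
      have := ENNReal.tendsto_ofReal (hlim0.const_mul C)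
      simpa using this
    refine tendsto_of_tendsto_of_tendsto_of_le_of_le' tendsto_const_nhds h0
      (Eventually.of_forall fun _ => zero_le) ?_
    filter_upwards [hev] with n hn using (hdiff n).trans hn
  refine lt_of_le_of_lt (hmem.trans ?_) (ENNReal.ofReal_lt_top (r := 2 * C))
  refine Filter.liminf_le_of_frequently_le' (Filter.Eventually.frequently ?_)
  filter_upwards [hev] with n hn
  refine (hslope n).trans ((mul_le_mul_right hn _).trans ?_)
  rw [← ENNReal.ofReal_coe_nnreal, ← ENNReal.ofReal_mul (hkpos n).le]
  apply ENNReal.ofReal_le_ofReal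
  have := (hkpos n).ne'
  field_simp
  exact le_of_eq (by ring)

theorem cheegerConst_lt_top {X : Type*} [MetricSpace X] [CompleteSpace X]
    [MeasurableSpace X] [BorelSpace X]
    (m : Measure X)
    (hbdd : ∀ s : Set X, Bornology.IsBounded s → m s < ⊤)
    (hsupp : ∀ U : Set X, IsOpen U → U.Nonempty → 0 < m U)
    (hpos : 0 < m Set.univ)
    (hdiam : 0 < EMetric.diam (Set.univ : Set X)) :
    cheegerConst m < ⊤ := by
  have hne : ∃ x y : X, x ≠ y := by
    by_contra! hcon
    have : (Set.univ : Set X).Subsingleton := fun a _ b _ => hcon a b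
    exact hdiam.ne' (Metric.ediam_subsingleton this)
  obtain ⟨x, y, hxy⟩ := hne
  have hd : 0 < dist x y := dist_pos.2 hxy
  have hdisj : Disjoint (Metric.ball x (dist x y / 2)) (Metric.ball y (dist x y / 2)) :=
    Metric.ball_disjoint_ball (by linarith)
  have hsum : m (Metric.ball x (dist x y / 2)) + m (Metric.ball y (dist x y / 2))
      ≤ m Set.univ := by
    rw [← measure_union hdisj Metric.isOpen_ball.measurableSet]
    exact measure_mono (Set.subset_univ _)
  have hz : ∃ z : X, m (Metric.ball z (dist x y / 2)) ≤ m Set.univ / 2 := by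
    by_contra! hcon
    have := ENNReal.add_lt_add (hcon x) (hcon y)
    rw [ENNReal.add_halves] at this
    exact absurd hsum (not_le.2 this)
  obtain ⟨z, hz⟩ := hz
  obtain ⟨s, hs0, hsr, C, hC⟩ := exists_radius m hbdd z (dist x y / 2) (by linarith)
  have hper := perimeter_lt_top m z s C hC
  have hApos : 0 < m (Metric.closedBall z s) :=
    (hsupp _ Metric.isOpen_ball ⟨z, Metric.mem_ball_self hs0⟩).trans_le
      (measure_mono Metric.ball_subset_closedBall)
  have hAfin := hbdd _ (Metric.isBounded_closedBall (x := z) (r := s))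
  have hlt : perimeter m (Metric.closedBall z s) / m (Metric.closedBall z s) < ⊤ :=
    ENNReal.div_lt_top hper.ne hApos.ne'
  unfold cheegerConst
  split_ifs with hX
  · exact lt_of_le_of_lt (sInf_le ⟨_, measurableSet_closedBall, hApos,
      (measure_mono (Metric.closedBall_subset_ball hsr)).trans hz, rfl⟩) hlt
  · exact lt_of_le_of_lt (sInf_le ⟨_, measurableSet_closedBall, hApos, hAfin, rfl⟩) hlt
end
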